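/- arXiv:2108.07928 — 2 statements merged into one kernel-verified Lean document; each statement's English description precedes it below -/
import Mathlib

section
/- Let H be a real symmetric positive definite (p+q)×(p+q) matrix written in blocks H₁₁ (p×p), H₁₂ (p×q), H₂₁ = H₁₂ᵀ (q×p), H₂₂ (q×q), and let g = (g₁, g₂) ∈ ℝ^p × ℝ^q. Then for every initial point (θ⁰, λ⁰) ∈ ℝ^p × ℝ^q, applying the implicit profiling update map T twice yields the unique stationary point of the quadratic objective: writing T²(θ⁰,λ⁰) = (θ², λ²), one has G₁(θ², λ²) = 0 and G₂(θ², λ²) = 0, i.e. the minimizer of Q is reached within two steps. -/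
open Matrix

namespace ImplicitProfiling

variable {m n 𝕜 : Type*} [Fintype n] [DecidableEq n] [Field 𝕜]

/-- One Newton step in the inner variable lands on the profiled value, whatever the start. -/
theorem sub_inv_mulVec_add (D : Matrix n n 𝕜) (hD : IsUnit D.det) (v l : n → 𝕜) :
    l - D⁻¹ *ᵥ (v + D *ᵥ l) = -(D⁻¹ *ᵥ v) := by
  rw [mulVec_add, mulVec_mulVec, nonsing_inv_mul D hD, one_mulVec]
  abel

theorem add_mulVec_neg_inv_mulVec (D : Matrix n n 𝕜) (hD : IsUnit D.det) (v : n → 𝕜) :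
    v + D *ᵥ (-(D⁻¹ *ᵥ v)) = 0 := by
  rw [mulVec_neg, mulVec_mulVec, mul_nonsing_inv D hD, one_mulVec, add_neg_cancel]

/-- The outer gradient at a profiled point is affine in `θ`, with linear part the
Schur complement. -/
theorem outer_gradient_at_profile [Fintype m] (A : Matrix m m 𝕜) (B : Matrix m n 𝕜)
    (C : Matrix n m 𝕜) (D : Matrix n n 𝕜) (g₁ : m → 𝕜) (g₂ : n → 𝕜) (θ : m → 𝕜) :
    g₁ + A *ᵥ θ + B *ᵥ (-(D⁻¹ *ᵥ (g₂ + C *ᵥ θ))) =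
      (g₁ - B *ᵥ D⁻¹ *ᵥ g₂) + (A - B * D⁻¹ * C) *ᵥ θ := by
  simp only [mulVec_neg, mulVec_add, sub_mulVec, ← mulVec_mulVec]
  abel

theorem isUnit_det_of_posDef_fromBlocks [Fintype m] [DecidableEq m] {A : Matrix m m ℝ}
    {B : Matrix m n ℝ} {C : Matrix n m ℝ} {D : Matrix n n ℝ} (h : (fromBlocks A B C D).PosDef) :
    IsUnit D.det ∧ IsUnit (A - B * D⁻¹ * C).det := by
  have hD : D.PosDef := h.submatrix (e := Sum.inr) Sum.inr_injective
  have := hD.isUnit.invertible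
  refine ⟨(isUnit_iff_isUnit_det D).1 hD.isUnit, (isUnit_iff_isUnit_det _).1 ?_⟩
  simpa only [invOf_eq_nonsing_inv] using isUnit_fromBlocks_iff_of_invertible₂₂.1 h.isUnit

end ImplicitProfiling

/-- For a symmetric positive definite block Hessian, applying the implicit
profiling update map `T` twice from any initial point reaches the stationary
point of the quadratic objective: both gradient components vanish. -/
theorem implicit_profiling_two_steps (p q : ℕ)
    (H11 : Matrix (Fin p) (Fin p) ℝ) (H12 : Matrix (Fin p) (Fin q) ℝ)
    (H22 : Matrix (Fin q) (Fin q) ℝ)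
    (hH : (Matrix.fromBlocks H11 H12 H12ᵀ H22).PosDef)
    (g1 : Fin p → ℝ) (g2 : Fin q → ℝ)
    (θ0 : Fin p → ℝ) (l0 : Fin q → ℝ) :
    let G1 : (Fin p → ℝ) → (Fin q → ℝ) → (Fin p → ℝ) :=
      fun θ l => g1 + H11 *ᵥ θ + H12 *ᵥ l
    let G2 : (Fin p → ℝ) → (Fin q → ℝ) → (Fin q → ℝ) :=
      fun θ l => g2 + H12ᵀ *ᵥ θ + H22 *ᵥ l
    let S : Matrix (Fin p) (Fin p) ℝ := H11 - H12 * H22⁻¹ * H12ᵀ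
    let T : (Fin p → ℝ) × (Fin q → ℝ) → (Fin p → ℝ) × (Fin q → ℝ) :=
      fun x =>
        let l' := x.2 - H22⁻¹ *ᵥ G2 x.1 x.2
        (x.1 - S⁻¹ *ᵥ G1 x.1 l', l')
    G1 (T (T (θ0, l0))).1 (T (T (θ0, l0))).2 = 0 ∧
      G2 (T (T (θ0, l0))).1 (T (T (θ0, l0))).2 = 0 := by
  intro G1 G2 S T
  obtain ⟨hD, hS⟩ := ImplicitProfiling.isUnit_det_of_posDef_fromBlocks hH
  have hT : ∀ x, T x =
      (-(S⁻¹ *ᵥ (g1 - H12 *ᵥ H22⁻¹ *ᵥ g2)), -(H22⁻¹ *ᵥ (g2 + H12ᵀ *ᵥ x.1))) := fun x => by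
    simp only [T, G1, G2, ImplicitProfiling.sub_inv_mulVec_add H22 hD,
      ImplicitProfiling.outer_gradient_at_profile]
    rw [ImplicitProfiling.sub_inv_mulVec_add S hS]
  simp only [hT]
  constructor
  · simp only [G1, ImplicitProfiling.outer_gradient_at_profile]
    exact ImplicitProfiling.add_mulVec_neg_inv_mulVec S hS _
  · exact ImplicitProfiling.add_mulVec_neg_inv_mulVec H22 hD _
end

section
/- Let H be a real symmetric positive definite (p+q)×(p+q) matrix with blocks H₁₁, H₁₂, H₂₁ = H₁₂ᵀ, H₂₂, let g = (g₁,g₂) ∈ ℝ^p × ℝ^q, and let (θ*, λ*) = −H⁻¹g be the unique stationary point of the quadratic objective Q. Then for every initial point (θ⁰, λ⁰), the θ-component of the first implicit profiling iterate already equals θ*: with λ¹ = λ⁰ − H₂₂⁻¹G₂(θ⁰,λ⁰) and θ¹ = θ⁰ − S⁻¹G₁(θ⁰,λ¹), one has θ¹ = θ*. -/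
open Matrix

/-- At a stationary point `(θs, ls)` with `H22` invertible, the profile gradient in `θ` is the
Schur complement applied to the displacement from `θs`. -/
theorem profile_gradient_eq_schur_mulVec {m n R : Type*} [Fintype m] [Fintype n] [DecidableEq n]
    [CommRing R] (H11 : Matrix m m R) (H12 : Matrix m n R) (H21 : Matrix n m R)
    (H22 : Matrix n n R) (h22 : IsUnit H22.det) (g1 : m → R) (g2 : n → R)
    (θs θ : m → R) (ls l : n → R)
    (h1 : g1 + H11 *ᵥ θs + H12 *ᵥ ls = 0) (h2 : g2 + H21 *ᵥ θs + H22 *ᵥ ls = 0) :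
    g1 + H11 *ᵥ θ + H12 *ᵥ (l - H22⁻¹ *ᵥ (g2 + H21 *ᵥ θ + H22 *ᵥ l)) =
      (H11 - H12 * H22⁻¹ * H21) *ᵥ (θ - θs) := by
  have hg1 : g1 = -(H11 *ᵥ θs) - H12 *ᵥ ls := by linear_combination h1
  have hg2 : g2 = -(H21 *ᵥ θs) - H22 *ᵥ ls := by linear_combination h2
  subst hg1 hg2
  simp only [mulVec_add, mulVec_sub, mulVec_neg, sub_mulVec, mulVec_mulVec,
    nonsing_inv_mul _ h22, one_mulVec, Matrix.mul_assoc]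
  abel

/-- For a symmetric positive definite block Hessian, the θ-component of the
first implicit profiling iterate already equals the θ-component of the unique
stationary point `-H⁻¹ g` of the quadratic objective. -/
theorem implicit_profiling_theta_one_step (p q : ℕ)
    (H11 : Matrix (Fin p) (Fin p) ℝ) (H12 : Matrix (Fin p) (Fin q) ℝ)
    (H22 : Matrix (Fin q) (Fin q) ℝ)
    (hH : (Matrix.fromBlocks H11 H12 H12ᵀ H22).PosDef)
    (g1 : Fin p → ℝ) (g2 : Fin q → ℝ)
    (θ0 : Fin p → ℝ) (l0 : Fin q → ℝ) :
    let G1 : (Fin p → ℝ) → (Fin q → ℝ) → (Fin p → ℝ) :=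
      fun θ l => g1 + H11 *ᵥ θ + H12 *ᵥ l
    let G2 : (Fin p → ℝ) → (Fin q → ℝ) → (Fin q → ℝ) :=
      fun θ l => g2 + H12ᵀ *ᵥ θ + H22 *ᵥ l
    let S : Matrix (Fin p) (Fin p) ℝ := H11 - H12 * H22⁻¹ * H12ᵀ
    let βstar : (Fin p ⊕ Fin q) → ℝ :=
      -((Matrix.fromBlocks H11 H12 H12ᵀ H22)⁻¹ *ᵥ Sum.elim g1 g2)
    let θstar : Fin p → ℝ := fun i => βstar (Sum.inl i)
    let l1 : Fin q → ℝ := l0 - H22⁻¹ *ᵥ G2 θ0 l0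
    let θ1 : Fin p → ℝ := θ0 - S⁻¹ *ᵥ G1 θ0 l1
    θ1 = θstar := by
  intro G1 G2 S βstar θstar l1 θ1
  have h22 : H22.PosDef := hH.submatrix Sum.inr_injective
  have h22u : IsUnit H22.det := (isUnit_iff_isUnit_det _).mp h22.isUnit
  have hSu : IsUnit S.det := by
    let _ := invertibleOfIsUnitDet H22 h22u
    have h := isUnit_fromBlocks_iff_of_invertible₂₂.mp hH.isUnit
    rw [invOf_eq_nonsing_inv] at h
    exact (isUnit_iff_isUnit_det _).mp h
  have hβ : fromBlocks H11 H12 H12ᵀ H22 *ᵥ βstar = -Sum.elim g1 g2 := by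
    simp only [βstar, mulVec_neg, mulVec_mulVec]
    rw [mul_nonsing_inv _ ((isUnit_iff_isUnit_det _).mp hH.isUnit), one_mulVec]
  rw [fromBlocks_mulVec] at hβ
  have h1 : g1 + H11 *ᵥ θstar + H12 *ᵥ (βstar ∘ Sum.inr) = 0 := by
    funext i
    have h : (H11 *ᵥ θstar + H12 *ᵥ (βstar ∘ Sum.inr)) i = -g1 i := congrFun hβ (Sum.inl i)
    simp only [Pi.add_apply, Pi.zero_apply] at h ⊢
    linarith
  have h2 : g2 + H12ᵀ *ᵥ θstar + H22 *ᵥ (βstar ∘ Sum.inr) = 0 := by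
    funext i
    have h : (H12ᵀ *ᵥ θstar + H22 *ᵥ (βstar ∘ Sum.inr)) i = -g2 i := congrFun hβ (Sum.inr i)
    simp only [Pi.add_apply, Pi.zero_apply] at h ⊢
    linarith
  have hG : G1 θ0 l1 = S *ᵥ (θ0 - θstar) :=
    profile_gradient_eq_schur_mulVec H11 H12 H12ᵀ H22 h22u g1 g2 θstar θ0 _ l0 h1 h2
  change θ0 - S⁻¹ *ᵥ G1 θ0 l1 = θstar
  rw [hG, mulVec_mulVec, nonsing_inv_mul _ hSu, one_mulVec, sub_sub_cancel]
end
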